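/- Let N ≥ 1 and C > 1. Suppose a ∈ C^∞(𝕋³) and ξ : ℝ³ → ℝ³ is smooth with ξ(x + 2πm) − ξ(x) ∈ 2πℤ³ for all x ∈ ℝ³ and m ∈ ℤ³ (so that x ↦ e^{ik·ξ(x)} is well defined on 𝕋³ for every k ∈ ℤ³), and suppose C⁻¹|w| ≤ |∇ξ(x)w| ≤ C|w| for all x ∈ ℝ³ and w ∈ ℝ³ (two-sided uniform bounds on the Jacobian matrix ∇ξ). Then for every k ∈ ℤ³∖{0}: |∫_{𝕋³} a(x) e^{ik·ξ(x)} dx| ≤ K(C,N) (‖a‖_N + ‖a‖₀ ‖∇ξ‖_N)/|k|^N, where the constant K(C,N) depends only on C and N and is independent of k. -/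

import Mathlib

open MeasureTheory Real

noncomputable section

/-- Points of physical space `ℝ³`. Periodic functions on `V3` model functions on `𝕋³`. -/
abbrev V3 : Type := Fin 3 → ℝ

/-- The fundamental domain `[-π,π]³` of the torus `𝕋³ = ℝ³/(2πℤ)³`. -/
def D3 : Set V3 := Set.Icc (fun _ => -π) (fun _ => π)

/-- `2πℤ³`-periodicity of a function on `ℝ³`. -/
def Per {E : Type*} (f : V3 → E) : Prop :=
  ∀ (x : V3) (m : Fin 3 → ℤ), f (x + fun i => 2 * π * (m i : ℝ)) = f x

/-- Euclidean dot product on `ℝ³`. -/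
def dot3 (x y : V3) : ℝ := ∑ i, x i * y i

/-- Euclidean norm on `ℝ³`. -/
def enorm3 (x : V3) : ℝ := Real.sqrt (∑ i, (x i)^2)

/-- The Jacobian matrix `∇ξ` of a map `ξ : ℝ³ → ℝ³`, as a matrix-valued field. -/
def jac (ξ : V3 → V3) (x : V3) : Fin 3 → Fin 3 → ℝ :=
  fun i j => fderiv ℝ (fun y => ξ y i) x (Pi.single j 1)

/-- Weighted derivative bounds up to order `n`. -/
def SB {F : Type} [NormedAddCommGroup F] [NormedSpace ℝ F] (n : ℕ) (B M : ℝ) (f : V3 → F) : Prop :=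
  ∀ j ≤ n, ∀ x, ‖iteratedFDeriv ℝ j f x‖ ≤ B * M ^ j

section SBsec
variable {F G : Type} [NormedAddCommGroup F] [NormedSpace ℝ F]
  [NormedAddCommGroup G] [NormedSpace ℝ G]

lemma le_top_nat (j : ℕ) : (j : WithTop ℕ∞) ≤ ((⊤ : ℕ∞) : WithTop ℕ∞) := by
  exact_mod_cast le_top

lemma SB.mono {n m : ℕ} {B B' M : ℝ} {f : V3 → F} (h : SB n B M f) (hm : m ≤ n) (hB : B ≤ B')
    (hM : 0 ≤ M) : SB m B' M f := fun j hj x =>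
  (h j (hj.trans hm) x).trans (mul_le_mul_of_nonneg_right hB (pow_nonneg hM _))

lemma SB.nonneg {n : ℕ} {B M : ℝ} {f : V3 → F} (h : SB n B M f) : 0 ≤ B := by
  have := (norm_nonneg _).trans (h 0 (Nat.zero_le _) 0)
  simpa using this

lemma SB.norm_le {n : ℕ} {B M : ℝ} {f : V3 → F} (h : SB n B M f) (x : V3) : ‖f x‖ ≤ B := by
  simpa using h 0 (Nat.zero_le _) x

lemma SB.smul {n : ℕ} {B B' M : ℝ} {f : V3 → ℝ} {g : V3 → F} (hM : 0 ≤ M)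
    (hf : ContDiff ℝ (⊤ : ℕ∞) f) (hg : ContDiff ℝ (⊤ : ℕ∞) g)
    (h : SB n B M f) (h' : SB n B' M g) : SB n (2 ^ n * B * B') M (fun x => f x • g x) := by
  intro j hj x
  have hB := h.nonneg
  have hB' := h'.nonneg
  refine (norm_iteratedFDeriv_smul_le hf hg x (le_top_nat j)).trans ?_
  have h1 : ∀ i ∈ Finset.range (j + 1),
      (j.choose i : ℝ) * ‖iteratedFDeriv ℝ i f x‖ * ‖iteratedFDeriv ℝ (j - i) g x‖
        ≤ (j.choose i : ℝ) * (B * B' * M ^ j) := by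
    intro i hi
    have hi' : i ≤ j := Nat.lt_succ_iff.mp (Finset.mem_range.mp hi)
    have e1 := h i (hi'.trans hj) x
    have e2 := h' (j - i) ((Nat.sub_le _ _).trans hj) x
    have e3 : M ^ j = M ^ i * M ^ (j - i) := by rw [← pow_add]; congr 1; omega
    rw [mul_assoc, e3]
    refine mul_le_mul_of_nonneg_left ?_ (Nat.cast_nonneg _)
    calc _ ≤ (B * M ^ i) * (B' * M ^ (j - i)) :=
          mul_le_mul e1 e2 (norm_nonneg _) (by positivity)
      _ = _ := by ring
  refine (Finset.sum_le_sum h1).trans ?_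
  rw [← Finset.sum_mul]
  have e4 : (∑ i ∈ Finset.range (j + 1), (j.choose i : ℝ)) = 2 ^ j := by
    exact_mod_cast Nat.sum_range_choose j
  rw [e4]
  have e5 : (2 : ℝ) ^ j ≤ 2 ^ n := pow_le_pow_right₀ (by norm_num) hj
  have : (0:ℝ) ≤ B * B' * M ^ j := by positivity
  nlinarith

lemma SB.mul {n : ℕ} {B B' M : ℝ} {f g : V3 → ℝ} (hM : 0 ≤ M)
    (hf : ContDiff ℝ (⊤ : ℕ∞) f) (hg : ContDiff ℝ (⊤ : ℕ∞) g)
    (h : SB n B M f) (h' : SB n B' M g) : SB n (2 ^ n * B * B') M (fun x => f x * g x) :=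
  SB.smul hM hf hg h h'

lemma SB.sum3 {n : ℕ} {B M : ℝ} {f : Fin 3 → V3 → F}
    (hf : ∀ i, ContDiff ℝ (⊤ : ℕ∞) (f i)) (h : ∀ i, SB n B M (f i)) :
    SB n (3 * B) M (fun x => ∑ i, f i x) := by
  intro j hj x
  have e := iteratedFDeriv_sum (𝕜 := ℝ) (i := j) (u := Finset.univ) (f := f)
    (fun i _ => (hf i).of_le (le_top_nat j))
  rw [e]
  simp only [Finset.sum_apply]
  refine (norm_sum_le _ _).trans ?_
  refine (Finset.sum_le_sum fun i _ => h i j hj x).trans ?_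
  simp [mul_assoc]

lemma SB.clm {n : ℕ} {B M c : ℝ} {f : V3 → F} (L : F →L[ℝ] G) (hL : ‖L‖ ≤ c)
    (hf : ContDiff ℝ (⊤ : ℕ∞) f) (h : SB n B M f) : SB n (c * B) M (fun x => L (f x)) := by
  intro j hj x
  have hB := h.nonneg
  refine (L.norm_iteratedFDeriv_comp_left (hf.contDiffAt (x := x)) (le_top_nat j)).trans ?_
  rw [mul_assoc]
  exact mul_le_mul hL (h j hj x) (norm_nonneg _) ((norm_nonneg _).trans hL)

lemma SB.fderiv {n : ℕ} {B M : ℝ} {f : V3 → F} (h : SB (n + 1) B M f) :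
    SB n (B * M) M (fun x => fderiv ℝ f x) := by
  intro j hj x
  have := h (j + 1) (by omega) x
  rw [← norm_iteratedFDeriv_fderiv] at this
  refine this.trans (le_of_eq ?_)
  ring

lemma SB.succ {n : ℕ} {B M : ℝ} {f : V3 → F} (h0 : ∀ x, ‖f x‖ ≤ B)
    (h : SB n (B * M) M (fun x => _root_.fderiv ℝ f x)) : SB (n + 1) B M f := by
  intro j hj x
  rcases j with _ | j
  · simpa using h0 x
  · rw [← norm_iteratedFDeriv_fderiv]
    refine (h j (by omega) x).trans (le_of_eq ?_)
    ring

lemma contDiff_fderiv_top {f : V3 → F} (hf : ContDiff ℝ (⊤ : ℕ∞) f) :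
    ContDiff ℝ (⊤ : ℕ∞) (fun x => fderiv ℝ f x) :=
  hf.fderiv_right (m := ((⊤ : ℕ∞) : WithTop ℕ∞)) (by exact_mod_cast le_top)

lemma contDiff_pd {f : V3 → F} (hf : ContDiff ℝ (⊤ : ℕ∞) f) (v : V3) :
    ContDiff ℝ (⊤ : ℕ∞) (fun x => fderiv ℝ f x v) :=
  (contDiff_fderiv_top hf).clm_apply contDiff_const

lemma SB.pd {n : ℕ} {B M : ℝ} {f : V3 → F} (hf : ContDiff ℝ (⊤ : ℕ∞) f)
    (h : SB (n + 1) B M f) (i : Fin 3) :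
    SB n (B * M) M (fun x => _root_.fderiv ℝ f x (Pi.single i 1)) := by
  have hL : ‖ContinuousLinearMap.apply ℝ F (Pi.single i 1 : V3)‖ ≤ 1 := by
    refine ContinuousLinearMap.opNorm_le_bound _ zero_le_one fun T => ?_
    have := T.le_opNorm (Pi.single i 1 : V3)
    simpa [Pi.norm_single] using this
  have := SB.clm _ hL (contDiff_fderiv_top hf) h.fderiv
  simpa using this

lemma SB_inv (n : ℕ) (B c : ℝ) (hc : 0 < c) : ∃ K : ℝ, ∀ (q : V3 → ℝ) (M : ℝ), 0 ≤ M →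
    ContDiff ℝ (⊤ : ℕ∞) q → (∀ x, c ≤ q x) → SB n B M q → SB n K M (fun x => (q x)⁻¹) := by
  have key : ∀ q : V3 → ℝ, (∀ x, c ≤ q x) → ∀ x, ‖(q x)⁻¹‖ ≤ c⁻¹ := by
    intro q hq x
    rw [Real.norm_of_nonneg (inv_nonneg.mpr (hc.le.trans (hq x)))]
    exact inv_anti₀ hc (hq x)
  induction n with
  | zero =>
    refine ⟨c⁻¹, fun q M hM hq hcq h j hj x => ?_⟩
    obtain rfl : j = 0 := by omega
    simpa using key q hcq x
  | succ n ih =>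
    obtain ⟨K, hK⟩ := ih
    refine ⟨max c⁻¹ (2 ^ n * (2 ^ n * K * K) * B), fun q M hM hq hcq h => ?_⟩
    have hq0 : ∀ x, q x ≠ 0 := fun x => (hc.trans_le (hcq x)).ne'
    have hinv : ContDiff ℝ (⊤ : ℕ∞) (fun x => (q x)⁻¹) := hq.inv hq0
    have h1 := hK q M hM hq hcq (h.mono (Nat.le_succ n) le_rfl hM)
    have h2 := SB.mul hM hinv hinv h1 h1
    have h3 := SB.smul hM (hinv.mul hinv) (contDiff_fderiv_top hq) h2 h.fderiv
    refine SB.succ (fun x => (key q hcq x).trans (le_max_left _ _)) ?_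
    have h4 : (fun x => _root_.fderiv ℝ (fun x => (q x)⁻¹) x) =
        fun x => (-ContinuousLinearMap.id ℝ (V3 →L[ℝ] ℝ))
          (((q x)⁻¹ * (q x)⁻¹) • _root_.fderiv ℝ q x) := by
      funext x
      have hd : DifferentiableAt ℝ q x := hq.differentiable (by simp) x
      have := ((hasDerivAt_inv (hq0 x)).comp_hasFDerivAt x hd.hasFDerivAt).fderiv
      have e : (fun x => (q x)⁻¹) = (Inv.inv ∘ q) := rfl
      rw [e, this]
      ext v
      simp [pow_two]
    rw [h4]
    have h5 := SB.clm (-ContinuousLinearMap.id ℝ (V3 →L[ℝ] ℝ)) (c := 1)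
      (by rw [norm_neg]; exact ContinuousLinearMap.norm_id_le)
      ((hinv.mul hinv).smul (contDiff_fderiv_top hq)) h3
    refine h5.mono le_rfl ?_ hM
    calc _ = (2 ^ n * (2 ^ n * K * K) * B) * M := by ring
      _ ≤ _ := mul_le_mul_of_nonneg_right (le_max_right _ _) hM

/-! Interpolation -/

lemma landau {f : V3 → F} (hf : ContDiff ℝ (⊤ : ℕ∞) f) {m0 m2 h : ℝ} (hh : 0 < h)
    (h0 : ∀ x, ‖f x‖ ≤ m0) (p2 : 0 ≤ m2)
    (h2 : ∀ x y, ‖fderiv ℝ f y - fderiv ℝ f x‖ ≤ m2 * ‖y - x‖) (x : V3) :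
    ‖fderiv ℝ f x‖ ≤ 2 / h * m0 + h * m2 := by
  have p0 : 0 ≤ m0 := (norm_nonneg _).trans (h0 0)
  refine ContinuousLinearMap.opNorm_le_of_unit_norm (by positivity) fun v hv => ?_
  have hd : Differentiable ℝ f := hf.differentiable (by simp)
  have hball : ∀ y ∈ Metric.closedBall x h, ‖fderiv ℝ f y - fderiv ℝ f x‖ ≤ m2 * h := by
    intro y hy
    refine (h2 x y).trans (mul_le_mul_of_nonneg_left ?_ p2)
    rwa [mem_closedBall_iff_norm] at hy
  have hy : x + h • v ∈ Metric.closedBall x h := by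
    rw [mem_closedBall_iff_norm]
    simp [norm_smul, hv, abs_of_pos hh]
  have := (convex_closedBall x h).norm_image_sub_le_of_norm_fderiv_le' (f := f)
    (fun z _ => hd z) hball (Metric.mem_closedBall_self hh.le) hy
  have e : x + h • v - x = h • v := by simp
  rw [e, norm_smul, hv, Real.norm_of_nonneg hh.le, map_smul, mul_one] at this
  have t1 : ‖h • fderiv ℝ f x v‖ ≤ m0 + m0 + m2 * h * h := by
    have : h • fderiv ℝ f x v = f (x + h • v) - f x
        - (f (x + h • v) - f x - h • fderiv ℝ f x v) := by abel
    rw [this]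
    refine (norm_sub_le _ _).trans (add_le_add ((norm_sub_le _ _).trans
      (add_le_add (h0 _) (h0 _))) (by assumption))
  rw [norm_smul, Real.norm_of_nonneg hh.le] at t1
  have : ‖fderiv ℝ f x v‖ ≤ (m0 + m0 + m2 * h * h) / h := by
    rw [le_div_iff₀ hh]; linarith
  refine this.trans (le_of_eq ?_)
  field_simp
  ring

lemma seq_lemma (n : ℕ) : ∀ ε : ℝ, 0 < ε → ∃ K : ℝ, 0 ≤ K ∧ ∀ (s : ℕ → ℝ) (N : ℕ), n + 1 ≤ N →
    (∀ j, 0 ≤ s j) →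
    (∀ j, j + 2 ≤ N → ∀ η : ℝ, 0 < η → s (j + 1) ≤ 2 / η * s j + η * s (j + 2)) →
    s n ≤ K * s 0 + ε * s (n + 1) := by
  induction n with
  | zero =>
    intro ε hε
    refine ⟨1, zero_le_one, fun s N hN h0 _ => ?_⟩
    have := mul_nonneg hε.le (h0 (0 + 1))
    linarith
  | succ n ih =>
    intro ε hε
    obtain ⟨K, hK0, hK⟩ := ih (ε / 8) (by positivity)
    refine ⟨8 * K / ε, by positivity, fun s N hN h0 h => ?_⟩
    have h1 := hK s N (by omega) h0 h
    have h2 := h n (by omega) (ε / 2) (by positivity)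
    have h3 : 2 / (ε / 2) * s n ≤ 2 / (ε / 2) * (K * s 0 + ε / 8 * s (n + 1)) :=
      mul_le_mul_of_nonneg_left h1 (by positivity)
    have h4 : 2 / (ε / 2) * (K * s 0 + ε / 8 * s (n + 1)) =
        (8 * K / ε * s 0) / 2 + s (n + 1) / 2 := by
      field_simp
      ring
    have : n + 1 + 1 = n + 2 := rfl
    rw [this]
    linarith

lemma seq_bound (N : ℕ) : ∃ K : ℝ, 1 ≤ K ∧ ∀ (s : ℕ → ℝ) (A : ℝ), 0 ≤ A →
    (∀ j, 0 ≤ s j) →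
    (∀ j, j + 2 ≤ N → ∀ η : ℝ, 0 < η → s (j + 1) ≤ 2 / η * s j + η * s (j + 2)) →
    s 0 ≤ A → s N ≤ A → ∀ j ≤ N, s j ≤ K * A := by
  choose K hK0 hK using fun n => seq_lemma n 1 one_pos
  set S := ∑ n ∈ Finset.range N, K n with hS
  have hS0 : 0 ≤ S := Finset.sum_nonneg fun n _ => hK0 n
  have hKS : ∀ n < N, K n ≤ S := fun n hn =>
    Finset.single_le_sum (f := K) (fun n _ => hK0 n) (Finset.mem_range.mpr hn)
  refine ⟨1 + N * S, by have : (0:ℝ) ≤ N * S := by positivity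
                        linarith, fun s A hA h0 h hs0 hsN => ?_⟩
  have key : ∀ i ≤ N, s (N - i) ≤ (1 + i * S) * A := by
    intro i
    induction i with
    | zero => intro _; simpa using hsN
    | succ i ih =>
      intro hi
      have e1 := ih (by omega)
      have e2 := hK (N - (i + 1)) s N (by omega) h0 h
      have e3 : N - (i + 1) + 1 = N - i := by omega
      rw [e3] at e2
      have e4 : K (N - (i + 1)) * s 0 ≤ S * A :=
        mul_le_mul (hKS _ (by omega)) hs0 (h0 0) hS0
      push_cast
      nlinarith
  intro j hj
  have := key (N - j) (by omega)
  rw [show N - (N - j) = j by omega] at this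
  refine this.trans (mul_le_mul_of_nonneg_right ?_ hA)
  have : ((N - j : ℕ) : ℝ) ≤ N := by exact_mod_cast Nat.sub_le _ _
  have := mul_le_mul_of_nonneg_right this hS0
  linarith

lemma interp (N : ℕ) : ∃ K : ℝ, 1 ≤ K ∧ ∀ (F : Type) [NormedAddCommGroup F] [NormedSpace ℝ F]
    (f : V3 → F) (A M B : ℝ), ContDiff ℝ (⊤ : ℕ∞) f → 0 < M →
    (∀ x, ∀ j ≤ N, ‖iteratedFDeriv ℝ j f x‖ ≤ B) → (∀ x, ‖f x‖ ≤ A) →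
    (∀ x, ‖iteratedFDeriv ℝ N f x‖ ≤ A * M ^ N) → SB N (K * A) M f := by
  obtain ⟨K, hK1, hK⟩ := seq_bound N
  refine ⟨K, hK1, ?_⟩
  intro F _ _ f A M B hf hM hB hA hN
  have hA0 : 0 ≤ A := (norm_nonneg _).trans (hA 0)
  set m : ℕ → ℝ := fun j => ⨆ x, ‖iteratedFDeriv ℝ j f x‖ with hm
  have hbdd : ∀ j ≤ N, BddAbove (Set.range fun x => ‖iteratedFDeriv ℝ j f x‖) := fun j hj =>
    ⟨B, by rintro _ ⟨x, rfl⟩; exact hB x j hj⟩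
  have hle : ∀ j ≤ N, ∀ x, ‖iteratedFDeriv ℝ j f x‖ ≤ m j := fun j hj x => le_ciSup (hbdd j hj) x
  have hm0 : ∀ j, 0 ≤ m j := fun j => Real.iSup_nonneg fun x => norm_nonneg _
  have hs := hK (fun j => m j / M ^ j) A hA0 (fun j => div_nonneg (hm0 j) (by positivity)) ?_ ?_ ?_
  · intro j hj x
    refine (hle j hj x).trans ?_
    have := hs j hj
    rwa [div_le_iff₀ (by positivity)] at this
  · intro j hj η hη
    have e : m (j + 1) ≤ 2 / (η / M) * m j + η / M * m (j + 2) := by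
      refine ciSup_le fun x => ?_
      rw [← norm_fderiv_iteratedFDeriv]
      have hg : ContDiff ℝ (⊤ : ℕ∞) (iteratedFDeriv ℝ j f) :=
        hf.iteratedFDeriv_right (m := ((⊤ : ℕ∞) : WithTop ℕ∞)) (by exact_mod_cast le_top)
      refine landau hg (by positivity) (hle j (by omega)) (hm0 _) (fun y z => ?_) x
      have e1 : ‖fderiv ℝ (iteratedFDeriv ℝ j f) z - fderiv ℝ (iteratedFDeriv ℝ j f) y‖ =
          ‖iteratedFDeriv ℝ (j + 1) f z - iteratedFDeriv ℝ (j + 1) f y‖ := by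
        have := (continuousMultilinearCurryLeftEquiv ℝ (fun _ : Fin (j + 1) => V3) F).symm.dist_map
          (fderiv ℝ (iteratedFDeriv ℝ j f) z) (fderiv ℝ (iteratedFDeriv ℝ j f) y)
        rw [dist_eq_norm, dist_eq_norm] at this
        exact this.symm
      rw [e1]
      have hg' : ContDiff ℝ (⊤ : ℕ∞) (iteratedFDeriv ℝ (j + 1) f) :=
        hf.iteratedFDeriv_right (m := ((⊤ : ℕ∞) : WithTop ℕ∞)) (by exact_mod_cast le_top)
      refine (convex_univ (𝕜 := ℝ) (E := V3)).norm_image_sub_le_of_norm_fderiv_le (𝕜 := ℝ)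
        (f := iteratedFDeriv ℝ (j + 1) f) (C := m (j + 2))
        (fun z _ => hg'.differentiable (by simp) z) (fun z _ => ?_) (Set.mem_univ y)
        (Set.mem_univ z)
      rw [norm_fderiv_iteratedFDeriv]
      exact hle _ hj z
    have hMj : 0 < M ^ j := by positivity
    calc m (j + 1) / M ^ (j + 1)
        ≤ (2 / (η / M) * m j + η / M * m (j + 2)) / M ^ (j + 1) := by gcongr
      _ = _ := by
        rw [pow_succ, pow_succ, pow_succ]
        field_simp
  · simp only [pow_zero, div_one]
    refine ciSup_le fun x => by simpa using hA x
  · rw [div_le_iff₀ (by positivity)]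
    exact ciSup_le hN

end SBsec

/-- The transposed transport operator. -/
def Tr (β : Fin 3 → V3 → ℝ) (f : V3 → ℝ) (x : V3) : ℝ :=
  ∑ i, fderiv ℝ (fun y => β i y * f y) x (Pi.single i 1)

lemma Tr_contDiff {β : Fin 3 → V3 → ℝ} {f : V3 → ℝ} (hβ : ∀ i, ContDiff ℝ (⊤ : ℕ∞) (β i))
    (hf : ContDiff ℝ (⊤ : ℕ∞) f) : ContDiff ℝ (⊤ : ℕ∞) (Tr β f) :=
  ContDiff.sum fun i _ => contDiff_pd ((hβ i).mul hf) _

lemma Per.pd {E : Type*} [NormedAddCommGroup E] [NormedSpace ℝ E] {f : V3 → E} (h : Per f)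
    (v : V3) : Per (fun x => fderiv ℝ f x v) := by
  intro x m
  have e : (fun y => f (y + fun i => 2 * π * (m i : ℝ))) = f := funext fun y => h y m
  have := fderiv_comp_add_right (𝕜 := ℝ) (f := f) (x := x) (fun i => 2 * π * (m i : ℝ))
  rw [e] at this
  simp only [this]

lemma Tr_per {β : Fin 3 → V3 → ℝ} {f : V3 → ℝ} (hβ : ∀ i, Per (β i)) (hf : Per f) :
    Per (Tr β f) := by
  intro x m
  unfold Tr
  refine Finset.sum_congr rfl fun i _ => ?_
  have : Per (fun y => β i y * f y) := fun y m => by simp only [hβ i y m, hf y m]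
  exact this.pd _ x m

lemma Tr_bound {β : Fin 3 → V3 → ℝ} {f : V3 → ℝ} {N n : ℕ} {Kβ B M : ℝ} (hM : 0 ≤ M)
    (hβ : ∀ i, ContDiff ℝ (⊤ : ℕ∞) (β i)) (hf : ContDiff ℝ (⊤ : ℕ∞) f)
    (h : ∀ i, SB N Kβ M (β i)) (h' : SB (n + 1) B M f) (hn : n + 1 ≤ N) :
    SB n (3 * 2 ^ N * Kβ * M * B) M (Tr β f) := by
  have h1 := fun i => SB.pd ((hβ i).mul hf)
    (SB.mul hM (hβ i) hf ((h i).mono hn le_rfl hM) h') i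
  have h2 := SB.sum3 (fun i => contDiff_pd ((hβ i).mul hf) (Pi.single i 1)) h1
  refine SB.mono h2 le_rfl ?_ hM
  have e : (2:ℝ) ^ (n + 1) ≤ 2 ^ N := pow_le_pow_right₀ (by norm_num) hn
  have k0 := (h 0).nonneg
  have b0 := h'.nonneg
  calc _ = 2 ^ (n + 1) * (3 * Kβ * M * B) := by ring
    _ ≤ 2 ^ N * (3 * Kβ * M * B) := mul_le_mul_of_nonneg_right e (by positivity)
    _ = _ := by ring

lemma int_div_zero (f : Fin 3 → V3 → ℂ) (hf : ∀ i, ContDiff ℝ (⊤ : ℕ∞) (f i))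
    (hp : ∀ i, Per (f i)) : ∫ x in D3, ∑ i, fderiv ℝ (f i) x (Pi.single i 1) = 0 := by
  unfold D3
  have hle : (fun _ => -π : V3) ≤ fun _ => π := fun _ => by
    have := Real.pi_pos
    simp only
    linarith
  rw [integral_divergence_of_hasFDerivAt_off_countable' (n := 2) (fun _ => -π) (fun _ => π) hle f
    (fun i x => fderiv ℝ (f i) x) ∅ Set.countable_empty (fun i => (hf i).continuous.continuousOn)
    (fun x _ i => ((hf i).differentiable (by simp) x).hasFDerivAt)]
  · refine Finset.sum_eq_zero fun i _ => ?_
    rw [sub_eq_zero]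
    congr 1
    funext x
    have := hp i (Fin.insertNth i (-π) x) (Pi.single i 1)
    rw [← this]
    congr 1
    funext j
    refine Fin.succAboveCases i ?_ (fun l => ?_) j
    · simp; ring
    · simp
  · refine ContinuousOn.integrableOn_compact isCompact_Icc (Continuous.continuousOn ?_)
    exact continuous_finsetSum _ fun i _ => (contDiff_pd (hf i) _).continuous

lemma exp_fderiv {φ : V3 → ℝ} (hφ : ContDiff ℝ (⊤ : ℕ∞) φ) (x v : V3) :
    fderiv ℝ (fun y => Complex.exp (Complex.I * (φ y : ℂ))) x v =
      Complex.exp (Complex.I * (φ x : ℂ)) * (Complex.I * (fderiv ℝ φ x v : ℂ)) := by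
  have h1 : HasFDerivAt (fun y => (φ y : ℂ)) (Complex.ofRealCLM.comp (fderiv ℝ φ x)) x :=
    Complex.ofRealCLM.hasFDerivAt.comp x (hφ.differentiable (by simp) x).hasFDerivAt
  have h2 := (h1.const_mul Complex.I).cexp
  rw [h2.fderiv]
  simp

lemma exp_contDiff {φ : V3 → ℝ} (hφ : ContDiff ℝ (⊤ : ℕ∞) φ) :
    ContDiff ℝ (⊤ : ℕ∞) (fun y => Complex.exp (Complex.I * (φ y : ℂ))) :=
  (contDiff_const.mul (Complex.ofRealCLM.contDiff.comp hφ)).cexp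

lemma ibp_step {φ a : V3 → ℝ} {β : Fin 3 → V3 → ℝ} {c : ℝ} (hφ : ContDiff ℝ (⊤ : ℕ∞) φ)
    (ha : ContDiff ℝ (⊤ : ℕ∞) a) (hβ : ∀ i, ContDiff ℝ (⊤ : ℕ∞) (β i))
    (hpe : Per (fun y => Complex.exp (Complex.I * (φ y : ℂ)))) (hpa : Per a)
    (hpβ : ∀ i, Per (β i)) (hc : ∀ x, ∑ i, β i x * fderiv ℝ φ x (Pi.single i 1) = c)
    (hc0 : 0 < c) :
    ‖∫ x in D3, (a x : ℂ) * Complex.exp (Complex.I * (φ x : ℂ))‖ =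
      ‖∫ x in D3, (Tr β a x : ℂ) * Complex.exp (Complex.I * (φ x : ℂ))‖ / c := by
  set e : V3 → ℂ := fun y => Complex.exp (Complex.I * (φ y : ℂ)) with he
  have hE : ContDiff ℝ (⊤ : ℕ∞) e := exp_contDiff hφ
  have hofR : ∀ g : V3 → ℝ, ContDiff ℝ (⊤ : ℕ∞) g → ContDiff ℝ (⊤ : ℕ∞) (fun x => (g x : ℂ)) :=
    fun g hg => Complex.ofRealCLM.contDiff.comp hg
  have hs : ∀ i, ContDiff ℝ (⊤ : ℕ∞) (fun x => ((β i x * a x : ℝ) : ℂ) * e x) := fun i =>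
    (hofR _ ((hβ i).mul ha)).mul hE
  have h0 := int_div_zero (fun i x => ((β i x * a x : ℝ) : ℂ) * e x) hs (fun i x m => by
    have := hpe x m
    simp only [hpβ i x m, hpa x m]
    rw [this])
  have hpt : ∀ x, ∑ i, fderiv ℝ (fun x => ((β i x * a x : ℝ) : ℂ) * e x) x (Pi.single i 1) =
      (Tr β a x : ℂ) * e x + Complex.I * c * ((a x : ℂ) * e x) := by
    intro x
    have h1 : ∀ i, fderiv ℝ (fun x => ((β i x * a x : ℝ) : ℂ) * e x) x (Pi.single i 1) =
        ((fderiv ℝ (fun y => β i y * a y) x (Pi.single i 1) : ℝ) : ℂ) * e x +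
        Complex.I * ((β i x * fderiv ℝ φ x (Pi.single i 1) : ℝ) : ℂ) * ((a x : ℂ) * e x) := by
      intro i
      have hd1 : HasFDerivAt (fun x => ((β i x * a x : ℝ) : ℂ))
          (Complex.ofRealCLM.comp (fderiv ℝ (fun y => β i y * a y) x)) x :=
        Complex.ofRealCLM.hasFDerivAt.comp x
          (((hβ i).mul ha).differentiable (by simp) x).hasFDerivAt
      have hd2 := (hE.differentiable (by simp) x).hasFDerivAt
      have h3 : fderiv ℝ e x (Pi.single i 1) =
        e x * (Complex.I * (fderiv ℝ φ x (Pi.single i 1) : ℂ)) := exp_fderiv hφ x _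
      rw [(hd1.fun_mul hd2).fderiv]
      simp only [add_apply, smul_apply, h3, ContinuousLinearMap.comp_apply, Complex.ofRealCLM_apply,
        smul_eq_mul]
      push_cast
      ring
    rw [Finset.sum_congr rfl fun i _ => h1 i, Finset.sum_add_distrib, ← Finset.sum_mul,
      ← Finset.sum_mul, ← Finset.mul_sum, ← Complex.ofReal_sum, ← Complex.ofReal_sum, hc x]
    rfl
  simp_rw [hpt] at h0
  have hint : ∀ g : V3 → ℝ, ContDiff ℝ (⊤ : ℕ∞) g → IntegrableOn (fun x => (g x : ℂ) * e x) D3 :=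
    fun g hg => ContinuousOn.integrableOn_compact isCompact_Icc
      ((hofR g hg).mul hE).continuous.continuousOn
  rw [integral_add (hint _ (Tr_contDiff hβ ha)) ((hint _ ha).const_mul _),
    integral_const_mul] at h0
  rw [eq_neg_of_add_eq_zero_left h0, norm_neg, norm_mul, norm_mul, Complex.norm_I,
    Complex.norm_real, Real.norm_of_nonneg hc0.le, one_mul, mul_div_cancel_left₀ _ hc0.ne']

lemma ibp_iter {φ : V3 → ℝ} {β : Fin 3 → V3 → ℝ} {c : ℝ} (hφ : ContDiff ℝ (⊤ : ℕ∞) φ)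
    (hβ : ∀ i, ContDiff ℝ (⊤ : ℕ∞) (β i))
    (hpe : Per (fun y => Complex.exp (Complex.I * (φ y : ℂ))))
    (hpβ : ∀ i, Per (β i)) (hc : ∀ x, ∑ i, β i x * fderiv ℝ φ x (Pi.single i 1) = c)
    (hc0 : 0 < c) {N : ℕ} {Kβ M : ℝ} (hM : 0 ≤ M) (hbβ : ∀ i, SB N Kβ M (β i)) :
    ∀ n ≤ N, ∀ (a : V3 → ℝ) (B : ℝ), ContDiff ℝ (⊤ : ℕ∞) a → Per a → SB n B M a →
    ‖∫ x in D3, (a x : ℂ) * Complex.exp (Complex.I * (φ x : ℂ))‖ ≤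
      (3 * 2 ^ N * Kβ * M) ^ n * B * volume.real D3 / c ^ n := by
  intro n
  induction n with
  | zero =>
    intro _ a B ha hpa hb
    have hfin : volume D3 < ⊤ := isCompact_Icc.measure_lt_top
    have := norm_setIntegral_le_of_norm_le_const (μ := volume) (s := D3) (C := B)
      (f := fun x => (a x : ℂ) * Complex.exp (Complex.I * (φ x : ℂ))) hfin (fun x _ => by
        rw [norm_mul, mul_comm Complex.I, Complex.norm_exp_ofReal_mul_I, mul_one,
          Complex.norm_real]
        exact hb.norm_le x)
    simpa using this
  | succ n ih =>
    intro hn a B ha hpa hb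
    rw [ibp_step hφ ha hβ hpe hpa hpβ hc hc0]
    have := ih (by omega) (Tr β a) _ (Tr_contDiff hβ ha) (Tr_per hpβ hpa)
      (Tr_bound hM hβ ha hbβ hb hn)
    rw [div_le_iff₀ hc0]
    refine this.trans (le_of_eq ?_)
    rw [pow_succ (3 * 2 ^ N * Kβ * M), pow_succ c]
    field_simp

lemma beta_bound (N : ℕ) (B c : ℝ) (hc : 0 < c) : ∃ K : ℝ, 0 ≤ K ∧
    ∀ (p : Fin 3 → V3 → ℝ) (M : ℝ), 0 ≤ M → (∀ j, ContDiff ℝ (⊤ : ℕ∞) (p j)) →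
    (∀ j, SB N B M (p j)) → (∀ x, c ≤ ∑ i, p i x * p i x) →
    ∀ j, SB N K M (fun x => p j x * (∑ i, p i x * p i x)⁻¹) := by
  obtain ⟨K, hK⟩ := SB_inv N (3 * (2 ^ N * B * B)) c hc
  refine ⟨max 0 (2 ^ N * B * K), le_max_left _ _, fun p M hM hp hb hlow j => ?_⟩
  have hq : ContDiff ℝ (⊤ : ℕ∞) (fun x => ∑ i, p i x * p i x) :=
    ContDiff.sum fun i _ => (hp i).mul (hp i)
  have h1 := hK _ M hM hq hlow
    (SB.sum3 (fun i => (hp i).mul (hp i)) fun i => SB.mul hM (hp i) (hp i) (hb i) (hb i))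
  have h2 := SB.mul hM (hp j) (hq.inv fun x => (hc.trans_le (hlow x)).ne') (hb j) h1
  exact h2.mono le_rfl (le_max_right _ _) hM

lemma enorm3_sq (x : V3) : enorm3 x ^ 2 = ∑ i, x i ^ 2 :=
  Real.sq_sqrt (Finset.sum_nonneg fun i _ => sq_nonneg _)

lemma enorm3_nonneg (x : V3) : 0 ≤ enorm3 x := Real.sqrt_nonneg _

lemma abs_le_enorm3 (x : V3) (i : Fin 3) : |x i| ≤ enorm3 x := by
  refine Real.abs_le_sqrt ?_
  exact Finset.single_le_sum (f := fun i => x i ^ 2) (fun i _ => sq_nonneg _) (Finset.mem_univ i)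

lemma enorm3_eq_zero {x : V3} (h : enorm3 x = 0) : x = 0 := by
  funext i
  have := abs_le_enorm3 x i
  rw [h] at this
  exact abs_eq_zero.mp (le_antisymm this (abs_nonneg _))

lemma grad_lower {C : ℝ} (hC : 0 < C) (A : V3 →L[ℝ] V3)
    (hA : ∀ w, C⁻¹ * enorm3 w ≤ enorm3 (A w)) (k : V3) :
    (C ^ 2)⁻¹ * enorm3 k ^ 2 ≤ ∑ j, (∑ i, k i * A (Pi.single j 1) i) ^ 2 := by
  have hinj : Function.Injective (A : V3 →ₗ[ℝ] V3) := by
    rw [injective_iff_map_eq_zero]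
    intro w hw
    have h1 := hA w
    have h2 : A w = 0 := hw
    rw [h2] at h1
    have h3 : enorm3 (0 : V3) = 0 := by simp [enorm3]
    rw [h3] at h1
    apply enorm3_eq_zero
    have h4 : 0 < C⁻¹ := inv_pos.mpr hC
    have h5 := enorm3_nonneg w
    nlinarith
  obtain ⟨w, hw⟩ := (LinearMap.injective_iff_surjective.mp hinj) k
  have hw' : A w = k := hw
  have hsum : ∑ j, w j * (∑ i, k i * A (Pi.single j 1) i) = enorm3 k ^ 2 := by
    rw [enorm3_sq]
    have e1 : A w = ∑ j, w j • A (Pi.single j 1) := by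
      conv_lhs => rw [pi_eq_sum_univ' w]
      rw [map_sum]
      refine Finset.sum_congr rfl fun j _ => ?_
      rw [map_smul]
    simp_rw [Finset.mul_sum]
    rw [Finset.sum_comm]
    refine Finset.sum_congr rfl fun i _ => ?_
    have e2 : k i = ∑ j, w j * A (Pi.single j 1) i := by
      conv_lhs => rw [← hw', e1]
      simp
    have e3 : k i ^ 2 = k i * ∑ j, w j * A (Pi.single j 1) i := by rw [← e2, pow_two]
    rw [e3, Finset.mul_sum]
    exact Finset.sum_congr rfl fun j _ => by ring
  have hcs := Finset.sum_mul_sq_le_sq_mul_sq Finset.univ w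
    (fun j => ∑ i, k i * A (Pi.single j 1) i)
  rw [hsum, ← enorm3_sq] at hcs
  set S := ∑ j, (∑ i, k i * A (Pi.single j 1) i) ^ 2 with hS
  have hS0 : 0 ≤ S := Finset.sum_nonneg fun i _ => sq_nonneg _
  have h1 : enorm3 w ≤ C * enorm3 k := by
    have := hA w
    rw [hw', inv_mul_le_iff₀ hC] at this
    exact this
  have h2 : enorm3 w ^ 2 ≤ C ^ 2 * enorm3 k ^ 2 := by
    rw [← mul_pow]
    exact pow_le_pow_left₀ (enorm3_nonneg w) h1 2
  rw [inv_mul_le_iff₀ (by positivity)]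
  rcases (sq_nonneg (enorm3 k)).eq_or_lt with h | h
  · rw [← h]; positivity
  · have := mul_le_mul_of_nonneg_right h2 hS0
    have h5 : enorm3 k ^ 2 * enorm3 k ^ 2 ≤ (C ^ 2 * S) * enorm3 k ^ 2 := by nlinarith
    exact le_of_mul_le_mul_right h5 h

lemma jac_eq {ξ : V3 → V3} (hξ : ContDiff ℝ (⊤ : ℕ∞) ξ) (x : V3) (i j : Fin 3) :
    jac ξ x i j = fderiv ℝ ξ x (Pi.single j 1) i := by
  have h := (hξ.differentiable (by simp) x).hasFDerivAt
  have := (hasFDerivAt_pi'.mp h i).fderiv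
  unfold jac
  rw [this]
  rfl

lemma jac_contDiff {ξ : V3 → V3} (hξ : ContDiff ℝ (⊤ : ℕ∞) ξ) :
    ContDiff ℝ (⊤ : ℕ∞) (fun y => jac ξ y) := by
  refine contDiff_pi.mpr fun i => contDiff_pi.mpr fun j => ?_
  exact contDiff_pd (contDiff_pi.mp hξ i) _

lemma jac_norm {ξ : V3 → V3} (hξ : ContDiff ℝ (⊤ : ℕ∞) ξ) {C : ℝ} (hC : 0 ≤ C)
    (h : ∀ x w : V3, enorm3 (fderiv ℝ ξ x w) ≤ C * enorm3 w) (x : V3) : ‖jac ξ x‖ ≤ C := by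
  refine (pi_norm_le_iff_of_nonneg hC).mpr fun i => (pi_norm_le_iff_of_nonneg hC).mpr fun j => ?_
  rw [jac_eq hξ]
  refine (abs_le_enorm3 _ i).trans ((h x _).trans ?_)
  have : enorm3 (Pi.single j 1) = 1 := by
    unfold enorm3
    simp [Pi.single_apply]
  rw [this, mul_one]

lemma dot_fderiv {ξ : V3 → V3} (hξ : ContDiff ℝ (⊤ : ℕ∞) ξ) (k : V3) (x : V3) (j : Fin 3) :
    fderiv ℝ (fun y => dot3 k (ξ y)) x (Pi.single j 1) = ∑ i, k i * jac ξ x i j := by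
  have h := hasFDerivAt_pi'.mp (hξ.differentiable (by simp) x).hasFDerivAt
  have h2 : HasFDerivAt (fun y => dot3 k (ξ y))
      (∑ i, k i • ((ContinuousLinearMap.proj i).comp (fderiv ℝ ξ x))) x :=
    HasFDerivAt.fun_sum fun i _ => (h i).const_mul (k i)
  rw [h2.fderiv]
  simp [jac_eq hξ]

lemma dot_contDiff {ξ : V3 → V3} (hξ : ContDiff ℝ (⊤ : ℕ∞) ξ) (k : V3) :
    ContDiff ℝ (⊤ : ℕ∞) (fun y => dot3 k (ξ y)) :=
  ContDiff.sum fun i _ => contDiff_const.mul (contDiff_pi.mp hξ i)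

lemma exp_per {ξ : V3 → V3} (k : Fin 3 → ℤ)
    (h : ∀ (x : V3) (m : Fin 3 → ℤ), ∃ k : Fin 3 → ℤ,
          (ξ (x + fun i => 2 * π * (m i : ℝ)) - ξ x) = fun i => 2 * π * (k i : ℝ)) :
    Per (fun y => Complex.exp (Complex.I * (dot3 (fun i => (k i : ℝ)) (ξ y) : ℂ))) := by
  intro x m
  obtain ⟨l, hl⟩ := h x m
  have e1 : ξ (x + fun i => 2 * π * (m i : ℝ)) = ξ x + fun i => 2 * π * (l i : ℝ) := by
    rw [← hl]; abel
  have e2 : dot3 (fun i => (k i : ℝ)) (ξ (x + fun i => 2 * π * (m i : ℝ))) =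
      dot3 (fun i => (k i : ℝ)) (ξ x) + ((∑ i, k i * l i : ℤ) : ℝ) * (2 * π) := by
    rw [e1]
    unfold dot3
    push_cast
    rw [Finset.sum_mul, ← Finset.sum_add_distrib]
    refine Finset.sum_congr rfl fun i _ => ?_
    simp only [Pi.add_apply]
    ring
  simp only [e2]
  rw [Complex.exp_eq_exp_iff_exists_int]
  refine ⟨∑ i, k i * l i, ?_⟩
  push_cast
  ring

lemma phase_per {φ : V3 → ℝ} (hφ : ContDiff ℝ (⊤ : ℕ∞) φ)
    (hpe : Per (fun y => Complex.exp (Complex.I * (φ y : ℂ)))) (v : V3) :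
    Per (fun x => fderiv ℝ φ x v) := by
  intro x m
  have h1 := hpe.pd v x m
  simp only [exp_fderiv hφ] at h1
  have h2 := hpe x m
  simp only at h2
  rw [h2] at h1
  have h3 := mul_left_cancel₀ Complex.I_ne_zero (mul_left_cancel₀ (Complex.exp_ne_zero _) h1)
  exact_mod_cast h3

lemma lin_bound {u : V3} (hu : ∀ i, |u i| ≤ 1) (j : Fin 3) :
    ∃ L : (Fin 3 → Fin 3 → ℝ) →L[ℝ] ℝ, ‖L‖ ≤ 3 ∧ ∀ m, L m = ∑ i, u i * m i j := by
  refine ⟨∑ i, u i • ((ContinuousLinearMap.proj (R := ℝ) (φ := fun _ : Fin 3 => ℝ) j).comp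
    (ContinuousLinearMap.proj (R := ℝ) (φ := fun _ : Fin 3 => Fin 3 → ℝ) i)), ?_, fun m => ?_⟩
  · refine ContinuousLinearMap.opNorm_le_bound _ (by norm_num) fun m => ?_
    have : ∀ i ∈ Finset.univ, ‖u i * m i j‖ ≤ ‖m‖ := fun i _ => by
      rw [norm_mul]
      have e1 : ‖m i j‖ ≤ ‖m‖ := (norm_le_pi_norm (m i) j).trans (norm_le_pi_norm m i)
      have e2 : ‖u i‖ ≤ 1 := hu i
      nlinarith [norm_nonneg (m i j), norm_nonneg (u i)]
    have h := norm_sum_le_of_le Finset.univ this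
    simpa using h
  · simp

/-- **Nonstationary phase estimate** (Lemma A.2 of De Lellis–Kwon). If `a ∈ C^∞(𝕋³)` and
`ξ : ℝ³ → ℝ³` descends to the torus with `C⁻¹ ≤ |∇ξ| ≤ C`, then for every `k ∈ ℤ³∖{0}`
`|∫_{𝕋³} a(x) e^{i k·ξ(x)} dx| ≤ K(C,N) (‖a‖_N + ‖a‖₀‖∇ξ‖_N)/|k|^N`. -/
theorem nonstationary_phase (N : ℕ) (hN : 1 ≤ N) (C : ℝ) (hC : 1 < C) :
    ∃ K : ℝ, 0 < K ∧
      ∀ (a : V3 → ℝ) (ξ : V3 → V3),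
        ContDiff ℝ (⊤ : ℕ∞) a → Per a → ContDiff ℝ (⊤ : ℕ∞) ξ →
        (∀ (x : V3) (m : Fin 3 → ℤ), ∃ k : Fin 3 → ℤ,
          (ξ (x + fun i => 2 * π * (m i : ℝ)) - ξ x) = fun i => 2 * π * (k i : ℝ)) →
        (∀ x w : V3,
          C⁻¹ * enorm3 w ≤ enorm3 (fderiv ℝ ξ x w) ∧
          enorm3 (fderiv ℝ ξ x w) ≤ C * enorm3 w) →
        ∀ Aa A0 Agrad : ℝ,
          (∀ x : V3, ∀ j : ℕ, j ≤ N → ‖iteratedFDeriv ℝ j a x‖ ≤ Aa) →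
          (∀ x : V3, |a x| ≤ A0) →
          (∀ x : V3, ∀ j : ℕ, j ≤ N → ‖iteratedFDeriv ℝ j (fun y => jac ξ y) x‖ ≤ Agrad) →
        ∀ k : Fin 3 → ℤ, k ≠ 0 →
          ‖∫ x in D3, (a x : ℂ) *
              Complex.exp (Complex.I * (dot3 (fun i => (k i : ℝ)) (ξ x) : ℂ))‖
            ≤ K * (Aa + A0 * Agrad) / (enorm3 (fun i => (k i : ℝ))) ^ N := by
  obtain ⟨K1, hK1, hint⟩ := interp N
  have hC0 : 0 < C := by linarith
  obtain ⟨Kβ, hKβ, hbeta⟩ := beta_bound N (3 * (K1 * C)) ((C ^ 2)⁻¹) (by positivity)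
  have hV : 0 ≤ volume.real D3 := measureReal_nonneg
  refine ⟨(3 * 2 ^ N * Kβ) ^ N * K1 * volume.real D3 + 1, by positivity, ?_⟩
  intro a ξ ha hpa hξ hper hjac Aa A0 Agrad hAa hA0 hAg k hk
  set κ := enorm3 (fun i => (k i : ℝ)) with hκ
  have hκ0 : 0 < κ := by
    refine lt_of_le_of_ne (enorm3_nonneg _) fun h => hk ?_
    funext i
    have := congrFun (enorm3_eq_zero h.symm) i
    simpa using this
  have ha' : ∀ x, |a x| ≤ Aa := fun x => by simpa using hAa x 0 (Nat.zero_le _)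
  have hAg0 : 0 ≤ Agrad := (norm_nonneg _).trans (hAg 0 0 (Nat.zero_le _))
  have hA00 : 0 ≤ A0 := (abs_nonneg _).trans (hA0 0)
  have hAa0 : 0 ≤ Aa := (abs_nonneg _).trans (ha' 0)
  set A := min A0 Aa with hA
  have haA : ∀ x, ‖a x‖ ≤ A := fun x => le_min (hA0 x) (ha' x)
  have hAnn : 0 ≤ A := le_min hA00 hAa0
  rcases hAnn.eq_or_lt with hAz | hApos
  · have haz : ∀ x, a x = 0 := fun x => by
      have := haA x
      rw [← hAz] at this
      exact norm_le_zero_iff.mp this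
    simp only [haz]
    simp only [Complex.ofReal_zero, zero_mul, integral_zero, norm_zero]
    positivity
  -- the frequency scale
  set Q := max (Agrad / C) (Aa / A) with hQ
  have hQpos : 0 < Q := by
    have : 0 < Aa / A := div_pos (hApos.trans_le (min_le_right _ _)) hApos
    exact this.trans_le (le_max_right _ _)
  set M := Q ^ ((N : ℝ)⁻¹) with hMdef
  have hMpos : 0 < M := Real.rpow_pos_of_pos hQpos _
  have hMN : M ^ N = Q := Real.rpow_inv_natCast_pow hQpos.le (by omega)
  have hAQ : A * Q ≤ Aa + A0 * Agrad := by
    rw [hQ, mul_max_of_nonneg _ _ hAnn]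
    refine max_le ?_ ?_
    · have e1 : Agrad / C ≤ Agrad := div_le_self hAg0 hC.le
      have e2 : A * (Agrad / C) ≤ A0 * Agrad :=
        mul_le_mul (min_le_left _ _) e1 (by positivity) hA00
      linarith
    · rw [mul_div_cancel₀ _ hApos.ne']
      have := mul_nonneg hA00 hAg0
      linarith
  have hSa : SB N (K1 * A) M a := by
    refine hint ℝ a A M Aa ha hMpos hAa haA fun x => ?_
    refine (hAa x N le_rfl).trans ?_
    rw [hMN]
    calc Aa = A * (Aa / A) := by rw [mul_div_cancel₀ _ hApos.ne']
      _ ≤ A * Q := mul_le_mul_of_nonneg_left (le_max_right _ _) hAnn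
  have hSj : SB N (K1 * C) M (fun y => jac ξ y) := by
    refine hint _ _ C M Agrad (jac_contDiff hξ) hMpos hAg
      (jac_norm hξ hC0.le fun x w => (hjac x w).2) fun x => ?_
    refine (hAg x N le_rfl).trans ?_
    rw [hMN]
    calc Agrad = C * (Agrad / C) := by rw [mul_div_cancel₀ _ hC0.ne']
      _ ≤ C * Q := mul_le_mul_of_nonneg_left (le_max_left _ _) hC0.le
  -- normalised phase gradient
  set φ : V3 → ℝ := fun y => dot3 (fun i => (k i : ℝ)) (ξ y) with hφdef
  have hφ : ContDiff ℝ (⊤ : ℕ∞) φ := dot_contDiff hξ _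
  have hpe := exp_per k hper
  set p : Fin 3 → V3 → ℝ := fun j x => ∑ i, ((k i : ℝ) / κ) * jac ξ x i j with hp
  have hpφ : ∀ j x, fderiv ℝ φ x (Pi.single j 1) = κ * p j x := by
    intro j x
    rw [hφdef, dot_fderiv hξ, hp]
    simp only
    rw [Finset.mul_sum]
    refine Finset.sum_congr rfl fun i _ => ?_
    field_simp
  have hpper : ∀ j, Per (p j) := by
    intro j x m
    have := phase_per hφ hpe (Pi.single j 1) x m
    simp only [hpφ] at this
    exact mul_left_cancel₀ hκ0.ne' this
  have hu : ∀ i, |(fun i => (k i : ℝ) / κ) i| ≤ 1 := fun i => by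
    simp only
    rw [abs_div, abs_of_pos hκ0, div_le_one hκ0]
    exact abs_le_enorm3 (fun i => (k i : ℝ)) i
  have hpb : ∀ j, ContDiff ℝ (⊤ : ℕ∞) (p j) ∧ SB N (3 * (K1 * C)) M (p j) := by
    intro j
    obtain ⟨L, hL, hLe⟩ := lin_bound hu j
    have e : p j = fun x => L (jac ξ x) := by
      funext x
      rw [hLe]
    rw [e]
    exact ⟨L.contDiff.comp (jac_contDiff hξ), SB.clm L hL (jac_contDiff hξ) hSj⟩
  have hlow : ∀ x, (C ^ 2)⁻¹ ≤ ∑ i, p i x * p i x := by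
    intro x
    have h1 := grad_lower hC0 (fderiv ℝ ξ x) (fun w => (hjac x w).1) (fun i => (k i : ℝ))
    simp_rw [← jac_eq hξ] at h1
    have h2 : ∀ j, ∑ i, (k i : ℝ) * jac ξ x i j = κ * p j x := fun j => by
      rw [← hpφ, hφdef, dot_fderiv hξ]
    simp_rw [h2, mul_pow] at h1
    rw [← Finset.mul_sum, mul_comm, ← hκ] at h1
    have h3 := le_of_mul_le_mul_left h1 (by positivity)
    simpa [pow_two] using h3
  have hqpos : ∀ x, 0 < ∑ i, p i x * p i x := fun x =>
    lt_of_lt_of_le (by positivity) (hlow x)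
  set β : Fin 3 → V3 → ℝ := fun j x => p j x * (∑ i, p i x * p i x)⁻¹ with hβdef
  have hβs : ∀ j, ContDiff ℝ (⊤ : ℕ∞) (β j) := fun j =>
    (hpb j).1.mul ((ContDiff.sum fun i _ => (hpb i).1.mul (hpb i).1).inv fun x => (hqpos x).ne')
  have hβb : ∀ j, SB N Kβ M (β j) :=
    hbeta p M hMpos.le (fun j => (hpb j).1) (fun j => (hpb j).2) hlow
  have hβp : ∀ j, Per (β j) := fun j x m => by
    simp only [hβdef, fun i => hpper i x m]
  have hc : ∀ x, ∑ i, β i x * fderiv ℝ φ x (Pi.single i 1) = κ := by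
    intro x
    have : ∀ i, β i x * fderiv ℝ φ x (Pi.single i 1) =
        (κ * (∑ i, p i x * p i x)⁻¹) * (p i x * p i x) := fun i => by
      rw [hpφ, hβdef]; ring
    rw [Finset.sum_congr rfl fun i _ => this i, ← Finset.mul_sum, mul_assoc,
      inv_mul_cancel₀ (hqpos x).ne', mul_one]
  have hfin := ibp_iter hφ hβs hpe hβp hc hκ0 hMpos.le hβb N le_rfl a (K1 * A) ha hpa hSa
  refine hfin.trans (div_le_div_of_nonneg_right ?_ (by positivity))
  have hR : 0 ≤ Aa + A0 * Agrad := by positivity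
  calc (3 * 2 ^ N * Kβ * M) ^ N * (K1 * A) * volume.real D3
      = ((3 * 2 ^ N * Kβ) ^ N * K1 * volume.real D3) * (A * Q) := by
        rw [mul_pow _ M, hMN]; ring
    _ ≤ ((3 * 2 ^ N * Kβ) ^ N * K1 * volume.real D3) * (Aa + A0 * Agrad) :=
        mul_le_mul_of_nonneg_left hAQ (by positivity)
    _ ≤ _ := mul_le_mul_of_nonneg_right (by linarith) hR
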